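/- arXiv:2002.05422 — 8 statements merged into one kernel-verified Lean document; each statement's English description precedes it below -/
import Mathlib

section
/- Let P ∈ ℝ² and let l : [a,b] → ℝ² be a loop (a continuous map with l(a) = l(b)) whose image does not contain P. Suppose the winding number of l about P equals 2kπ for an integer k ≠ 0. Then l is not contractible in ℝ² \ {P}, i.e., l is not freely null-homotopic within the complement of P (there is no continuous contraction of l to a point whose image avoids P). -/
/-- Counterclockwise rotation of the plane (identified with `ℂ`) about the origin
by angle `α`: `(x,y) ↦ (x cos α − y sin α, x sin α + y cos α)`. -/
noncomputable def rot (α : ℝ) (v : ℂ) : ℂ :=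
  ⟨v.re * Real.cos α - v.im * Real.sin α, v.re * Real.sin α + v.im * Real.cos α⟩

theorem int_const_aux {a b : ℝ} (hab : a ≤ b) {f : ℝ → ℝ} (hf : ContinuousOn f (Set.Icc a b))
    (h : ∀ t ∈ Set.Icc a b, ∃ n : ℤ, f t = n * (2 * Real.pi)) : f a = f b := by
  have hd : IsDiscrete (Set.range ((↑) : ℤ → ℝ)) := by
    rw [isDiscrete_iff_discreteTopology]
    exact Int.isClosedEmbedding_coe_real.isEmbedding.toHomeomorph.symm.isEmbedding.discreteTopology
  have h2 : (2 * Real.pi) ≠ 0 := by positivity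
  have := isPreconnected_Icc.constant_of_mapsTo hd (f := fun t => f t / (2 * Real.pi))
    (hf.div_const _) (fun t ht => by
      obtain ⟨n, hn⟩ := h t ht
      exact ⟨n, by simp only [hn]; field_simp⟩)
    (Set.left_mem_Icc.2 hab) (Set.right_mem_Icc.2 hab)
  simpa [div_left_inj' h2] using this

theorem exp_im_aux {z w : ℂ} (h : Complex.exp z = Complex.exp w) :
    ∃ n : ℤ, z.im - w.im = n * (2 * Real.pi) := by
  obtain ⟨n, hn⟩ := Complex.exp_eq_exp_iff_exists_int.1 h
  exact ⟨n, by rw [hn]; simp⟩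

/-- A loop `l : [a,b] → ℝ²` avoiding a point `P`, whose winding
number about `P` (computed from continuous polar coordinates `(ρ, φ)`) equals
`2kπ` with `k ≠ 0`, is not contractible in `ℝ² \ {P}`: there is no continuous
contraction `H(h,t)` (defined on the triangle `a ≤ h ≤ t ≤ b`, starting at `l`,
with each `t ↦ H(h,t)` a loop, hence ending at a point) whose image avoids `P`. -/
theorem loop_with_nonzero_winding_not_contractible
    (a b : ℝ) (hab : a ≤ b) (P : ℂ) (l : ℝ → ℂ)
    (hl : ContinuousOn l (Set.Icc a b)) (hloop : l a = l b)
    (hP : ∀ t ∈ Set.Icc a b, l t ≠ P)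
    (ρ φ : ℝ → ℝ)
    (hρ : ContinuousOn ρ (Set.Icc a b)) (hφ : ContinuousOn φ (Set.Icc a b))
    (hρpos : ∀ t ∈ Set.Icc a b, 0 < ρ t)
    (hpolar : ∀ t ∈ Set.Icc a b,
      l t = P + (ρ t : ℝ) • (⟨Real.cos (φ t), Real.sin (φ t)⟩ : ℂ))
    (k : ℤ) (hk : k ≠ 0) (hwind : φ b - φ a = 2 * k * Real.pi) :
    ¬ ∃ H : ℝ → ℝ → ℂ,
      ContinuousOn (fun p : ℝ × ℝ => H p.1 p.2)
        {p : ℝ × ℝ | a ≤ p.1 ∧ p.1 ≤ p.2 ∧ p.2 ≤ b} ∧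
      (∀ t ∈ Set.Icc a b, H a t = l t) ∧
      (∀ h ∈ Set.Icc a b, H h h = H h b) ∧
      (∀ h t : ℝ, a ≤ h → h ≤ t → t ≤ b → H h t ≠ P) := by
  rintro ⟨H, hc, h0, hlp, hne⟩
  let r : ℝ × ℝ → ℝ × ℝ := fun p =>
    (max a (min b p.1), max (max a (min b p.1)) (min b p.2))
  have hr : Continuous r := by fun_prop
  have hrm : ∀ p, r p ∈ {p : ℝ × ℝ | a ≤ p.1 ∧ p.1 ≤ p.2 ∧ p.2 ≤ b} := fun p =>
    ⟨le_max_left _ _, le_max_left _ _, by simp [r, hab]⟩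
  have hrid : ∀ h t, a ≤ h → h ≤ t → t ≤ b → r (h, t) = (h, t) := by
    intro h t h1 h2 h3
    simp [r, h1, h2, h3, h2.trans h3]
  let G : C(ℝ × ℝ, ℂ) := ⟨fun p => H (r p).1 (r p).2 - P,
    (hc.comp_continuous hr hrm).sub continuous_const⟩
  have hG : ∀ h t, a ≤ h → h ≤ t → t ≤ b → G (h, t) = H h t - P := by
    intro h t h1 h2 h3
    simp [G, hrid h t h1 h2 h3]
  have hG0 : ∀ p, G p ≠ 0 := fun p =>
    sub_ne_zero.2 (hne _ _ (hrm p).1 (hrm p).2.1 (hrm p).2.2)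
  obtain ⟨L, ⟨-, hL⟩, -⟩ := Complex.isCoveringMapOn_exp.existsUnique_continuousMap_lifts G
    (a₀ := (0, 0)) (e₀ := Complex.log (G (0, 0))) (Complex.exp_log (hG0 _)) (fun p => hG0 p)
  have hL' : ∀ p, Complex.exp (L p) = G p := fun p => congrFun hL p
  have e1 := int_const_aux hab (f := fun h => (L (h, b)).im - (L (h, h)).im)
    (Continuous.continuousOn (by fun_prop)) (fun t ht => exp_im_aux (by
      rw [hL', hL', hG _ _ ht.1 ht.2 le_rfl, hG _ _ ht.1 le_rfl ht.2, hlp t ht]))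
  have e2 := int_const_aux hab (f := fun t => (L (a, t)).im - φ t)
    ((Continuous.continuousOn (by fun_prop)).sub hφ) (fun t ht => by
      have := exp_im_aux (z := L (a, t)) (w := (Real.log (ρ t) : ℂ) + φ t * Complex.I) (by
        rw [hL', hG _ _ le_rfl ht.1 ht.2, h0 t ht, hpolar t ht, Complex.exp_add,
          ← Complex.ofReal_exp, Real.exp_log (hρpos t ht), Complex.exp_mul_I]
        apply Complex.ext <;> simp [← Complex.ofReal_cos, ← Complex.ofReal_sin])
      simpa using this)
  simp only [sub_self] at e1 e2
  have h3 : 2 * (k : ℝ) * Real.pi = 0 := by linarith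
  simp [hk, Real.pi_ne_zero] at h3
end

section
/- Let γ : [0,1] → ℝ² be a C¹ curve with constant speed c > 0, normalized so that γ(0) = (0,0), let θ be a turning angle function for γ with θ(0) = 0, and assume θ(1) = 2mπ for some integer m. Then for every t ∈ [0,1], the endpoint of the rearranged curve obtained by swapping the two arcs [0,t] and [t,1] satisfies E(0,t) = R_{θ(1)−θ(t)}(γ(t)) + R_{−θ(t)}(γ(1) − γ(t)) = R_{−θ(t)}(γ(1)). In particular, the loop t ↦ E(0,t) traces within the circle of radius ‖γ(1)‖ centered at the origin. -/
/-- Endpoint of the rearranged curve `r_{(c₁,c₂)}` (split `γ` at `c₁ ≤ c₂` and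
concatenate the three arcs in the order first, third, second, matching tangent
directions at the junctions):
`E(c₁,c₂) = γ(c₁) + R_{θ(c₁)−θ(c₂)}(γ(1)−γ(c₂)) + R_{θ(1)−θ(c₂)}(γ(c₂)−γ(c₁))`. -/
noncomputable def rearrEnd (γ : ℝ → ℂ) (θ : ℝ → ℝ) (c₁ c₂ : ℝ) : ℂ :=
  γ c₁ + rot (θ c₁ - θ c₂) (γ 1 - γ c₂) + rot (θ 1 - θ c₂) (γ c₂ - γ c₁)

/-- For a `C¹` constant-speed curve `γ` with `γ(0) = 0`, turning
angle `θ` with `θ(0) = 0` and `θ(1) = 2mπ`, the endpoint of the two-arc swap at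
`t` satisfies `E(0,t) = R_{θ(1)−θ(t)}(γ(t)) + R_{−θ(t)}(γ(1)−γ(t)) = R_{−θ(t)}(γ(1))`;
in particular the loop `t ↦ E(0,t)` stays on the circle of radius `‖γ(1)‖`
centered at the origin. -/
theorem endpoint_of_two_arc_swap
    (γ : ℝ → ℂ) (θ : ℝ → ℝ) (c : ℝ) (hc : 0 < c)
    (hγ0 : γ 0 = 0) (hθ0 : θ 0 = 0)
    (hθ : ContinuousOn θ (Set.Icc 0 1))
    (hderiv : ∀ s ∈ Set.Icc (0:ℝ) 1,
      HasDerivAt γ (c • (⟨Real.cos (θ s), Real.sin (θ s)⟩ : ℂ)) s)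
    (m : ℤ) (hm : θ 1 = 2 * m * Real.pi) :
    ∀ t ∈ Set.Icc (0:ℝ) 1,
      rearrEnd γ θ 0 t = rot (θ 1 - θ t) (γ t) + rot (-θ t) (γ 1 - γ t) ∧
      rearrEnd γ θ 0 t = rot (-θ t) (γ 1) ∧
      ‖rearrEnd γ θ 0 t‖ = ‖γ 1‖ := by
  intro t _
  have hc1 : Real.cos (θ 1 - θ t) = Real.cos (-θ t) := by
    rw [hm, show 2 * (m:ℝ) * Real.pi - θ t = -θ t + m * (2 * Real.pi) by ring]
    exact Real.cos_add_int_mul_two_pi _ _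
  have hs1 : Real.sin (θ 1 - θ t) = Real.sin (-θ t) := by
    rw [hm, show 2 * (m:ℝ) * Real.pi - θ t = -θ t + m * (2 * Real.pi) by ring]
    exact Real.sin_add_int_mul_two_pi _ _
  have h1 : rearrEnd γ θ 0 t = rot (θ 1 - θ t) (γ t) + rot (-θ t) (γ 1 - γ t) := by
    simp only [rearrEnd, hγ0, hθ0, zero_sub, sub_zero, zero_add]
    exact add_comm _ _
  have h2 : rearrEnd γ θ 0 t = rot (-θ t) (γ 1) := by
    rw [h1]
    simp only [rot, hc1, hs1]
    apply Complex.ext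
    · simp only [Complex.add_re, Complex.sub_re, Complex.sub_im]
      ring
    · simp only [Complex.add_im, Complex.sub_re, Complex.sub_im]
      ring
  refine ⟨h1, h2, ?_⟩
  rw [h2, Complex.norm_def, Complex.norm_def]
  congr 1
  simp only [rot, Complex.normSq_apply]
  linear_combination ((γ 1).re ^ 2 + (γ 1).im ^ 2) * Real.sin_sq_add_cos_sq (-θ t)
end

section
/- (Two-cut theorem) Let γ : [0,1] → ℝ² be a C¹ curve with constant speed c > 0, normalized so that γ(0) = (0,0), and let θ be a turning angle function for γ with θ(0) = 0. If θ(1) − θ(0) = 2mπ for some nonzero integer m, then there exist cuts 0 ≤ c₁ ≤ c₂ ≤ 1 such that E(c₁,c₂) = (0,0), i.e., the rearranged curve r_{(c₁,c₂)} is a closed curve; moreover its initial and final tangent directions agree (they differ by an integer multiple of 2π), so r_{(c₁,c₂)} is a closed C¹ curve. -/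
theorem rot_eq (α : ℝ) (v : ℂ) : rot α v = Complex.exp (α * Complex.I) * v := by
  rw [Complex.exp_mul_I, ← Complex.ofReal_cos, ← Complex.ofReal_sin]
  apply Complex.ext <;> simp [rot, -Complex.ofReal_cos, -Complex.ofReal_sin] <;> ring

theorem exp_lift_unique (f g : ℝ → ℂ) (hf : Continuous f) (hg : Continuous g)
    (h : ∀ x, Complex.exp (f x) = Complex.exp (g x)) (h0 : f 0 = g 0) (x : ℝ) : f x = g x :=
  congrFun (Complex.isCoveringMap_exp.eq_of_comp_eq hf hg
    (funext fun x => Subtype.ext (h x)) 0 h0) x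

theorem exists_zero_of_winding (g : ℝ → ℂ) (u : ℝ → ℝ) (G : ℂ) (hg : Continuous g)
    (hu : Continuous u) (hg0 : ∀ x ≤ 0, g x = 0) (hu0 : ∀ x ≤ 0, u x = 0)
    (hg1 : ∀ x ≥ 1, g x = G) (m : ℤ) (hm : m ≠ 0)
    (hu1 : ∀ x ≥ 1, u x = 2 * m * Real.pi) :
    ∃ a b : ℝ, a ≤ b ∧ g a * (Complex.exp (u b * Complex.I) - 1)
      - g b * (Complex.exp (u a * Complex.I) - 1) + Complex.exp (u a * Complex.I) * G = 0 := by
  by_contra! hne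
  have he1 : ∀ x ≥ 1, Complex.exp (u x * Complex.I) = 1 := by
    intro x hx
    rw [hu1 x hx, Complex.exp_eq_one_iff]
    exact ⟨m, by push_cast; ring⟩
  have he0 : ∀ x ≤ 0, Complex.exp (u x * Complex.I) = 1 := by
    intro x hx
    simp [hu0 x hx]
  have hG : G ≠ 0 := by
    have := hne 0 0 le_rfl
    simpa [hg0 0 le_rfl, hu0 0 le_rfl] using this
  let F : C(ℝ × ℝ, ℂ) := ⟨fun p => g (min p.1 p.2) * (Complex.exp (u (max p.1 p.2) * Complex.I) - 1)
      - g (max p.1 p.2) * (Complex.exp (u (min p.1 p.2) * Complex.I) - 1)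
      + Complex.exp (u (min p.1 p.2) * Complex.I) * G, by fun_prop⟩
  have hF : ∀ p, F p ∈ ({0}ᶜ : Set ℂ) := fun p => hne _ _ min_le_max
  have F0 : ∀ y, F (0, y) = G := by
    intro y
    simp [F, he0 (min 0 y) (min_le_left _ _), hg0 (min 0 y) (min_le_left _ _)]
  have F1 : ∀ x, F (x, 1) = G := by
    intro x
    simp only [F, ContinuousMap.coe_mk, he1 (max x 1) (le_max_right _ _),
      hg1 (max x 1) (le_max_right _ _)]
    ring
  have Fd : ∀ x, F (x, x) = Complex.exp (u x * Complex.I) * G := by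
    intro x
    simp [F]
  obtain ⟨L, ⟨hL0, hL⟩, -⟩ := Complex.isCoveringMapOn_exp.existsUnique_continuousMap_lifts F
    (a₀ := ((0 : ℝ), (0 : ℝ))) (e₀ := Complex.log G) (by rw [F0, Complex.exp_log hG]) hF
  have hL' : ∀ p, Complex.exp (L p) = F p := fun p => congrFun hL p
  have A : L (0, 1) = Complex.log G :=
    exp_lift_unique (fun y => L (0, y)) (fun _ => Complex.log G) (by fun_prop) (by fun_prop)
      (fun y => by rw [hL', F0, Complex.exp_log hG]) hL0 1
  have B : L (1, 1) = Complex.log G :=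
    exp_lift_unique (fun x => L (x, 1)) (fun _ => Complex.log G) (by fun_prop) (by fun_prop)
      (fun y => by rw [hL', F1, Complex.exp_log hG]) A 1
  have C : L (1, 1) = u 1 * Complex.I + Complex.log G :=
    exp_lift_unique (fun x => L (x, x)) (fun x => u x * Complex.I + Complex.log G)
      (by fun_prop) (by fun_prop)
      (fun y => by rw [hL', Fd, Complex.exp_add, Complex.exp_log hG])
      (by simp [hL0, hu0 0 le_rfl]) 1
  rw [B, hu1 1 le_rfl] at C
  simp [hm, Real.pi_ne_zero] at C

/-- **Two-cut theorem.** If `γ : [0,1] → ℝ²` is a `C¹` curve of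
constant speed `c > 0` with `γ(0) = 0`, turning angle `θ` with `θ(0) = 0`, and
total turning angle `θ(1) − θ(0) = 2mπ` with `m ≠ 0`, then there are cuts
`0 ≤ c₁ ≤ c₂ ≤ 1` with `E(c₁,c₂) = 0`: the rearranged curve `r_{(c₁,c₂)}` is
closed; moreover its initial and final tangent angles differ by an integer
multiple of `2π`, so it is a closed `C¹` curve. -/
theorem two_cut_theorem
    (γ : ℝ → ℂ) (θ : ℝ → ℝ) (c : ℝ) (hc : 0 < c)
    (hγ0 : γ 0 = 0) (hθ0 : θ 0 = 0)
    (hθ : ContinuousOn θ (Set.Icc 0 1))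
    (hderiv : ∀ s ∈ Set.Icc (0:ℝ) 1,
      HasDerivAt γ (c • (⟨Real.cos (θ s), Real.sin (θ s)⟩ : ℂ)) s)
    (m : ℤ) (hm : m ≠ 0) (hturn : θ 1 - θ 0 = 2 * m * Real.pi) :
    ∃ c₁ c₂ : ℝ, 0 ≤ c₁ ∧ c₁ ≤ c₂ ∧ c₂ ≤ 1 ∧
      rearrEnd γ θ c₁ c₂ = 0 ∧
      ∃ n : ℤ, ((θ c₁ - θ 0) + (θ 1 - θ c₂) + (θ c₂ - θ c₁)) - θ 0
        = 2 * n * Real.pi := by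
  have hγc : ContinuousOn γ (Set.Icc 0 1) := fun s hs =>
    (hderiv s hs).continuousAt.continuousWithinAt
  let P : ℝ → ℝ := fun x => max 0 (min 1 x)
  have hP : ∀ x, P x ∈ Set.Icc (0:ℝ) 1 := fun x =>
    ⟨le_max_left _ _, max_le zero_le_one (min_le_left _ _)⟩
  have hPc : Continuous P := by fun_prop
  have hP0 : ∀ x ≤ 0, P x = 0 := fun x hx => max_eq_left ((min_le_right _ _).trans hx)
  have hP1 : ∀ x ≥ 1, P x = 1 := fun x hx => by simp [P, min_eq_left hx]
  have hPm : Monotone P := fun x y h => max_le_max le_rfl (min_le_min le_rfl h)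
  have hθ1 : θ 1 = 2 * m * Real.pi := by rw [← hturn, hθ0, sub_zero]
  obtain ⟨a, b, hab, h⟩ := exists_zero_of_winding (fun x => γ (P x)) (fun x => θ (P x)) (γ 1)
    (hγc.comp_continuous hPc hP) (hθ.comp_continuous hPc hP)
    (fun x hx => by simp [hP0 x hx, hγ0]) (fun x hx => by simp [hP0 x hx, hθ0])
    (fun x hx => by simp [hP1 x hx]) m hm (fun x hx => by simp only [hP1 x hx, hθ1])
  refine ⟨P a, P b, (hP a).1, hPm hab, (hP b).2, ?_, m, ?_⟩
  · have e1 : Complex.exp (θ 1 * Complex.I) = 1 := by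
      rw [hθ1, Complex.exp_eq_one_iff]
      exact ⟨m, by push_cast; ring⟩
    have hb : Complex.exp (θ (P b) * Complex.I) ≠ 0 := Complex.exp_ne_zero _
    simp only [rearrEnd, rot_eq, Complex.ofReal_sub, sub_mul, Complex.exp_sub, e1]
    generalize Complex.exp (θ (P b) * Complex.I) = z at *
    generalize Complex.exp (θ (P a) * Complex.I) = w at *
    field_simp
    linear_combination h
  · rw [hθ0, hθ1]; ring
end

section
/- Let θ : [0,1] → ℝ be continuous with |θ(1) − θ(0)| ≥ 2π, let Q ∈ ℝ² with Q ≠ 0, and let u : [0,1] → ℝ² be continuous with ‖u(t) − Q‖ < ‖Q‖ for all t. Suppose l(t) := R_{−θ(t)}(u(t)) defines a loop, i.e., l(0) = l(1). Then l avoids the origin, and the winding number of l about the origin equals 2kπ for some nonzero integer k. -/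
/-- Let `θ : [0,1] → ℝ` be continuous with `|θ(1) − θ(0)| ≥ 2π`,
let `Q ≠ 0`, and let `u : [0,1] → ℝ²` be continuous with `‖u(t) − Q‖ < ‖Q‖` for
all `t`. If `l(t) := R_{−θ(t)}(u(t))` is a loop, then `l` avoids the origin, and
for any continuous polar coordinates `(ρ, φ)` of `l` with respect to the origin,
`φ(1) − φ(0) = 2kπ` for some nonzero integer `k`. -/
theorem loop_in_ball_rotated_has_nonzero_winding
    (θ : ℝ → ℝ) (hθ : ContinuousOn θ (Set.Icc 0 1))
    (hturn : |θ 1 - θ 0| ≥ 2 * Real.pi)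
    (Q : ℂ) (hQ : Q ≠ 0)
    (u : ℝ → ℂ) (hu : ContinuousOn u (Set.Icc 0 1))
    (hball : ∀ t ∈ Set.Icc (0:ℝ) 1, ‖u t - Q‖ < ‖Q‖)
    (hloop : rot (-θ 0) (u 0) = rot (-θ 1) (u 1)) :
    (∀ t ∈ Set.Icc (0:ℝ) 1, rot (-θ t) (u t) ≠ 0) ∧
    (∀ ρ φ : ℝ → ℝ, ContinuousOn ρ (Set.Icc 0 1) → ContinuousOn φ (Set.Icc 0 1) →
      (∀ t ∈ Set.Icc (0:ℝ) 1, 0 < ρ t) →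
      (∀ t ∈ Set.Icc (0:ℝ) 1,
        rot (-θ t) (u t) = (ρ t : ℝ) • (⟨Real.cos (φ t), Real.sin (φ t)⟩ : ℂ)) →
      ∃ k : ℤ, k ≠ 0 ∧ φ 1 - φ 0 = 2 * k * Real.pi) := by
  have hpos : ∀ t ∈ Set.Icc (0:ℝ) 1, 0 < (u t).re * Q.re + (u t).im * Q.im := by
    intro t ht
    have h := hball t ht
    have h2 : ‖u t - Q‖ ^ 2 < ‖Q‖ ^ 2 := by
      have := norm_nonneg (u t - Q)
      gcongr
    rw [← Complex.normSq_eq_norm_sq, ← Complex.normSq_eq_norm_sq, Complex.normSq_apply,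
      Complex.normSq_apply, Complex.sub_re, Complex.sub_im] at h2
    nlinarith [sq_nonneg (u t).re, sq_nonneg (u t).im]
  have hinv : ∀ t, (u t).re = (rot (-θ t) (u t)).re * Real.cos (θ t)
        - (rot (-θ t) (u t)).im * Real.sin (θ t) ∧
      (u t).im = (rot (-θ t) (u t)).re * Real.sin (θ t)
        + (rot (-θ t) (u t)).im * Real.cos (θ t) := by
    intro t
    have h1 := Real.sin_sq_add_cos_sq (θ t)
    simp only [rot, Real.cos_neg, Real.sin_neg]
    constructor
    · linear_combination (-(u t).re) * h1
    · linear_combination (-(u t).im) * h1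
  refine ⟨?_, ?_⟩
  · intro t ht h0
    have h := hpos t ht
    obtain ⟨h1, h2⟩ := hinv t
    rw [h0] at h1 h2
    simp at h1 h2
    rw [h1, h2] at h
    simp at h
  · intro ρ φ hρ hφ hρpos hl
    have hre : ∀ t ∈ Set.Icc (0:ℝ) 1, (rot (-θ t) (u t)).re = ρ t * Real.cos (φ t) := by
      intro t ht
      rw [hl t ht]; simp
    have him : ∀ t ∈ Set.Icc (0:ℝ) 1, (rot (-θ t) (u t)).im = ρ t * Real.sin (φ t) := by
      intro t ht
      rw [hl t ht]; simp
    have hc : ∀ t ∈ Set.Icc (0:ℝ) 1,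
        0 < Q.re * Real.cos (φ t + θ t) + Q.im * Real.sin (φ t + θ t) := by
      intro t ht
      have h := hpos t ht
      obtain ⟨h1, h2⟩ := hinv t
      rw [h1, h2, hre t ht, him t ht] at h
      have hr := hρpos t ht
      refine pos_of_mul_pos_right (a := ρ t) ?_ hr.le
      rw [Real.cos_add, Real.sin_add]
      linarith
    have m0 : (0:ℝ) ∈ Set.Icc (0:ℝ) 1 := by simp
    have m1 : (1:ℝ) ∈ Set.Icc (0:ℝ) 1 := by simp
    have hψ : ContinuousOn (fun t => φ t + θ t) (Set.Icc 0 1) := hφ.add hθ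
    have hup : φ 1 + θ 1 < φ 0 + θ 0 + Real.pi := by
      by_contra! hcon
      have hmem : φ 0 + θ 0 + Real.pi ∈ Set.Icc (φ 0 + θ 0) (φ 1 + θ 1) :=
        ⟨by linarith [Real.pi_pos], hcon⟩
      obtain ⟨t, ht, hte⟩ := intermediate_value_Icc zero_le_one hψ hmem
      have h := hc t ht
      have h0 := hc 0 m0
      simp only at hte
      rw [hte, Real.cos_add_pi, Real.sin_add_pi] at h
      linarith
    have hdn : φ 0 + θ 0 - Real.pi < φ 1 + θ 1 := by
      by_contra! hcon
      have hmem : φ 0 + θ 0 - Real.pi ∈ Set.Icc (φ 1 + θ 1) (φ 0 + θ 0) :=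
        ⟨hcon, by linarith [Real.pi_pos]⟩
      obtain ⟨t, ht, hte⟩ := intermediate_value_Icc' zero_le_one hψ hmem
      have h := hc t ht
      have h0 := hc 0 m0
      simp only at hte
      rw [hte, Real.cos_sub_pi, Real.sin_sub_pi] at h
      linarith
    have e1 : ρ 1 * Real.cos (φ 1) = ρ 0 * Real.cos (φ 0) := by
      rw [← hre 1 m1, ← hre 0 m0, hloop]
    have e2 : ρ 1 * Real.sin (φ 1) = ρ 0 * Real.sin (φ 0) := by
      rw [← him 1 m1, ← him 0 m0, hloop]
    have p0 := hρpos 0 m0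
    have p1 := hρpos 1 m1
    have e3 : ρ 1 = ρ 0 := by
      have : ρ 1 ^ 2 = ρ 0 ^ 2 := by
        linear_combination (ρ 1 * Real.cos (φ 1) + ρ 0 * Real.cos (φ 0)) * e1 +
          (ρ 1 * Real.sin (φ 1) + ρ 0 * Real.sin (φ 0)) * e2
          - ρ 1 ^ 2 * Real.sin_sq_add_cos_sq (φ 1) + ρ 0 ^ 2 * Real.sin_sq_add_cos_sq (φ 0)
      exact (pow_left_inj₀ p1.le p0.le two_ne_zero).1 this
    rw [e3] at e1 e2
    have c1 := mul_left_cancel₀ p0.ne' e1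
    have c2 := mul_left_cancel₀ p0.ne' e2
    obtain ⟨k, hk⟩ := Real.Angle.angle_eq_iff_two_pi_dvd_sub.1 (Real.Angle.cos_sin_inj c1 c2)
    refine ⟨k, ?_, by rw [hk]; ring⟩
    rintro rfl
    simp at hk
    have := Real.pi_pos
    rcases le_abs.1 hturn with h | h <;> linarith
end

section
/- Let γ : [0,1] → ℝ² be a C¹ constant speed non-closed planar curve (γ(1) ≠ γ(0)) with γ(0) = (0,0), and let θ be a turning angle function with θ(0) = 0 and θ(1) − θ(0) = 2mπ for a nonzero integer m. Let k ≥ 2 and let z_h ∈ Z_k be a cyclic shift. Then for every choice of cuts C = (c₁,…,c_{k−1}) ∈ D_k one has e_{z_h}(C) = R_{−θ(c_h)}(γ(1)) (with the convention c₀ = 0), so ‖e_{z_h}(C)‖ = ‖γ(1)‖ ≠ 0 and no cuts C ∈ D_k make the rearranged curve r_{z_h,C} closed. -/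
/-- A valid vector of cuts `(c₁,…,c_{k−1}) ∈ D_k`, encoded as `c : ℕ → ℝ` with the
conventions `c 0 = 0` and `c k = 1`: `0 = c₀ ≤ c₁ ≤ … ≤ c_{k−1} ≤ c_k = 1`. -/
def IsCuts (k : ℕ) (c : ℕ → ℝ) : Prop :=
  c 0 = 0 ∧ c k = 1 ∧ ∀ i < k, c i ≤ c (i + 1)

/-- Endpoint `e_σ(C)` of the rearranged curve `r_{σ,C}`: the arcs
`γ|_[c_{i−1}, c_i]` are concatenated in the order `σ(1),…,σ(k)`, matching tangent
directions at the junctions and starting at the origin with initial direction `0`;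
`e_σ(C) = Σ_{i=1}^k R_{β_i}(γ(c_{σ(i)}) − γ(c_{σ(i)−1}))` where
`β_i = Σ_{j=1}^{i−1} (θ(c_{σ(j)}) − θ(c_{σ(j)−1})) − θ(c_{σ(i)−1})`. -/
noncomputable def rearrangedEnd (k : ℕ) (γ : ℝ → ℂ) (θ : ℝ → ℝ)
    (σ : ℕ → ℕ) (c : ℕ → ℝ) : ℂ :=
  ∑ i ∈ Finset.Icc 1 k,
    rot ((∑ j ∈ Finset.Icc 1 (i - 1), (θ (c (σ j)) - θ (c (σ j - 1))))
          - θ (c (σ i - 1)))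
      (γ (c (σ i)) - γ (c (σ i - 1)))

/-- `σ` acts on `{1,…,k}` as the cyclic shift `z_h` for some `h ∈ {0,…,k−1}`,
where `z_h(i) = i + h` if `i ≤ k − h` and `z_h(i) = i + h − k` otherwise. -/
def IsCyclicShiftOn (k : ℕ) (σ : ℕ → ℕ) : Prop :=
  ∃ h < k, ∀ i ∈ Set.Icc 1 k, σ i = if i ≤ k - h then i + h else i + h - k

theorem shift_telescope {E : Type*} [AddCommGroup E] (f : ℕ → E)
    (k : ℕ) (σ : ℕ → ℕ) (h : ℕ) (hh : h < k)
    (hσ : ∀ i ∈ Set.Icc 1 k, σ i = if i ≤ k - h then i + h else i + h - k) (n : ℕ) (hn : n ≤ k) :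
    ∑ j ∈ Finset.Icc 1 n, (f (σ j) - f (σ j - 1)) =
      if n ≤ k - h then f (n + h) - f h else f k - f h + f (n + h - k) - f 0 := by
  induction n with
  | zero => simp
  | succ n ih =>
    rw [Finset.sum_Icc_succ_top (by omega), ih (by omega), hσ (n+1) ⟨by omega, hn⟩]
    by_cases h1 : n + 1 ≤ k - h
    · have h2 : n ≤ k - h := by omega
      have h3 : n + 1 + h - 1 = n + h := by omega
      simp only [h1, h2, if_true, h3]
      abel
    · by_cases h2 : n ≤ k - h
      · have h3 : n + 1 + h - k = 1 := by omega
        have h4 : n + h = k := by omega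
        simp only [h1, h2, if_true, if_false, h3, h4, Nat.sub_self]
        abel
      · have h3 : n + 1 + h - k - 1 = n + h - k := by omega
        simp only [h1, h2, if_false, h3]
        abel

theorem rot_eq_mul (α : ℝ) (v : ℂ) : rot α v = (⟨Real.cos α, Real.sin α⟩ : ℂ) * v := by
  apply Complex.ext <;> simp [rot] <;> ring

theorem rot_norm (α : ℝ) (v : ℂ) : ‖rot α v‖ = ‖v‖ := by
  have : (⟨Real.cos α, Real.sin α⟩ : ℂ) = Complex.exp (α * Complex.I) := by
    apply Complex.ext
    · simp [Complex.exp_ofReal_mul_I_re]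
    · simp [Complex.exp_ofReal_mul_I_im]
  rw [rot_eq_mul, norm_mul, this, Complex.norm_exp_ofReal_mul_I, one_mul]

/-- For a non-closed `C¹` constant-speed curve `γ` with
`γ(0) = 0`, turning angle `θ` with `θ(0) = 0` and `θ(1) − θ(0) = 2mπ`, `m ≠ 0`,
and a cyclic shift `σ = z_h ∈ Z_k` (`k ≥ 2`), every choice of cuts `C ∈ D_k`
gives `e_{z_h}(C) = R_{−θ(c_h)}(γ(1))`, hence `‖e_{z_h}(C)‖ = ‖γ(1)‖ ≠ 0` and no
cuts make the rearranged curve `r_{z_h,C}` closed. -/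
theorem cyclic_shift_never_closes
    (γ : ℝ → ℂ) (θ : ℝ → ℝ) (cs : ℝ) (hcs : 0 < cs)
    (hγ0 : γ 0 = 0) (hnc : γ 1 ≠ γ 0) (hθ0 : θ 0 = 0)
    (hθ : ContinuousOn θ (Set.Icc 0 1))
    (hderiv : ∀ s ∈ Set.Icc (0:ℝ) 1,
      HasDerivAt γ (cs • (⟨Real.cos (θ s), Real.sin (θ s)⟩ : ℂ)) s)
    (m : ℤ) (hm : m ≠ 0) (hturn : θ 1 - θ 0 = 2 * m * Real.pi)
    (k : ℕ) (hk : 2 ≤ k) (σ : ℕ → ℕ) (h : ℕ) (hh : h < k)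
    (hσ : ∀ i ∈ Set.Icc 1 k, σ i = if i ≤ k - h then i + h else i + h - k) :
    ∀ c : ℕ → ℝ, IsCuts k c →
      rearrangedEnd k γ θ σ c = rot (-θ (c h)) (γ 1) ∧
      ‖rearrangedEnd k γ θ σ c‖ = ‖γ 1‖ ∧
      rearrangedEnd k γ θ σ c ≠ 0 := by
  intro c hc
  obtain ⟨h0, h1, -⟩ := hc
  have key : rearrangedEnd k γ θ σ c = rot (-θ (c h)) (γ 1) := by
    have hterm : ∀ i ∈ Finset.Icc 1 k,
        rot ((∑ j ∈ Finset.Icc 1 (i - 1), (θ (c (σ j)) - θ (c (σ j - 1))))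
          - θ (c (σ i - 1))) (γ (c (σ i)) - γ (c (σ i - 1))) =
        (⟨Real.cos (-θ (c h)), Real.sin (-θ (c h))⟩ : ℂ) *
          (γ (c (σ i)) - γ (c (σ i - 1))) := by
      intro i hi
      rw [Finset.mem_Icc] at hi
      rw [rot_eq_mul, shift_telescope (fun n => θ (c n)) k σ h hh hσ (i - 1) (by omega)]
      congr 1
      have hs := hσ i hi
      by_cases h2 : i ≤ k - h
      · have h3 : i - 1 ≤ k - h := by omega
        have h4 : σ i - 1 = i - 1 + h := by rw [hs, if_pos h2]; omega
        rw [if_pos h3, h4]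
        have : θ (c (i - 1 + h)) - θ (c h) - θ (c (i - 1 + h)) = -θ (c h) := by ring
        rw [this]
      · have h4 : σ i - 1 = i - 1 + h - k := by rw [hs, if_neg h2]; omega
        have e : (if i - 1 ≤ k - h then θ (c (i - 1 + h)) - θ (c h)
            else θ (c k) - θ (c h) + θ (c (i - 1 + h - k)) - θ (c 0)) - θ (c (σ i - 1))
            = -θ (c h) + m * (2 * Real.pi) := by
          rw [h4]
          split_ifs with h3
          · have h5 : i - 1 + h = k := by omega
            rw [h5, Nat.sub_self, h1, h0]
            linarith
          · rw [h1, h0]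
            linarith
        rw [e, Real.cos_add_int_mul_two_pi, Real.sin_add_int_mul_two_pi]
    unfold rearrangedEnd
    rw [Finset.sum_congr rfl hterm, ← Finset.mul_sum,
      shift_telescope (fun n => γ (c n)) k σ h hh hσ k le_rfl, rot_eq_mul]
    congr 1
    split_ifs with h2
    · have : h = 0 := by omega
      subst this
      simp [h0, h1, hγ0]
    · have : k + h - k = h := by omega
      simp [this, h0, h1, hγ0]
  have hn : ‖rearrangedEnd k γ θ σ c‖ = ‖γ 1‖ := by rw [key, rot_norm]
  refine ⟨key, hn, ?_⟩
  rw [← norm_ne_zero_iff, hn, norm_ne_zero_iff, ← hγ0]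
  exact hnc
end

section
/- Let γ : [0,1] → ℝ² be a C¹ constant speed non-closed planar curve (γ(1) ≠ γ(0)) with γ(0) = (0,0), and θ a turning angle function with θ(0) = 0 and θ(1) − θ(0) = 2mπ for a nonzero integer m. Let σ be a permutation of {1,2,3}. Then there exist cuts C ∈ D_3 with e_σ(C) = (0,0) (i.e., γ is (3,1)-rearrangeable with respect to σ) if and only if σ is a transposition. -/
open Complex in
lemma rot_eq_exp (m : ℤ) (α β : ℝ) (k : ℤ) (h : α = β + k * (2 * m * Real.pi)) (v : ℂ) :
    rot α v = Complex.exp (β * I) * v := by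
  have h1 : Complex.exp (β * I) = Complex.exp (α * I) := by
    rw [Complex.exp_eq_exp_iff_exists_int]
    refine ⟨-(k * m), ?_⟩
    rw [h]; push_cast; ring
  rw [h1]
  apply Complex.ext <;>
    simp only [rot, Complex.mul_re, Complex.mul_im, Complex.exp_ofReal_mul_I_re,
      Complex.exp_ofReal_mul_I_im] <;> ring

open unitInterval in
lemma exists_zero_of_loop (G : I × I → ℂ) (hG : Continuous G) (w : ℂ) (φ : I → ℝ)
    (hφ : Continuous φ) (hφ0 : φ 0 = 0) (hφ1 : φ 1 ≠ 0)
    (h0 : ∀ u, G (0, u) = w) (hs0 : ∀ s, G (s, 0) = w) (hs1 : ∀ s, G (s, 1) = w)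
    (h1 : ∀ u, G (1, u) = Complex.exp (((-φ u : ℝ) : ℂ) * Complex.I) * w) :
    ∃ p, G p = 0 := by
  by_contra! hne
  have hw : w ≠ 0 := by rw [← h0 0]; exact hne _
  let X := {z : ℂ // z ≠ 0}
  let γ₀ : C(I, X) := .const I ⟨w, hw⟩
  let γ₁ : C(I, X) := ⟨fun u => ⟨G (1, u), hne _⟩, by fun_prop⟩
  have hom : γ₀.HomotopicRel γ₁ {0, 1} := ⟨
    { toFun := fun p => ⟨G p, hne _⟩
      continuous_toFun := by fun_prop
      map_zero_left := fun u => Subtype.ext (h0 u)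
      map_one_left := fun u => rfl
      prop' := by
        rintro t x (rfl | rfl)
        · exact Subtype.ext (hs0 t)
        · exact Subtype.ext (hs1 t) }⟩
  let P : ℂ → X := fun z => ⟨_, z.exp_ne_zero⟩
  have cov : IsCoveringMap P := Complex.isCoveringMap_exp
  have e0 : γ₀ 0 = P (Complex.log w) := Subtype.ext (Complex.exp_log hw).symm
  have e1 : γ₁ 0 = P (Complex.log w) := Subtype.ext ((hs0 1).trans (Complex.exp_log hw).symm)
  have key := cov.liftPath_apply_one_eq_of_homotopicRel hom (Complex.log w) e0 e1
  let Γ₁ : C(I, ℂ) := ⟨fun u => ((-φ u : ℝ) : ℂ) * Complex.I + Complex.log w, by fun_prop⟩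
  have k1 : Γ₁ = cov.liftPath γ₁ (Complex.log w) e1 := by
    rw [cov.eq_liftPath_iff']
    constructor
    · funext u
      apply Subtype.ext
      change Complex.exp (((-φ u : ℝ) : ℂ) * Complex.I + Complex.log w) = G (1, u)
      rw [h1, Complex.exp_add, Complex.exp_log hw]
    · simp [Γ₁, hφ0]
  have k0 : ContinuousMap.const I (Complex.log w) = cov.liftPath γ₀ (Complex.log w) e0 := by
    rw [cov.eq_liftPath_iff']
    exact ⟨funext fun u => e0.symm, rfl⟩
  rw [← k0, ← k1] at key
  simp [Γ₁] at key
  exact hφ1 key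

open unitInterval in
lemma exists_cuts (γ : ℝ → ℂ) (θ : ℝ → ℝ) (m : ℤ) (hm : m ≠ 0)
    (hγ0 : γ 0 = 0) (hθ0 : θ 0 = 0) (hγ : ContinuousOn γ (Set.Icc 0 1))
    (hθ : ContinuousOn θ (Set.Icc 0 1)) (hturn : θ 1 = 2 * m * Real.pi) :
    ∃ c : ℕ → ℝ, IsCuts 3 c ∧
      Complex.exp (((θ (c 2) - θ (c 1) : ℝ) : ℂ) * Complex.I) * (γ (c 1) - γ (c 0))
      + Complex.exp (((- θ (c 1) : ℝ) : ℂ) * Complex.I) * (γ (c 2) - γ (c 1))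
      + (γ (c 3) - γ (c 2)) = 0 := by
  let g : I → ℂ := fun x => γ x
  let t : I → ℝ := fun x => θ x
  have hg : Continuous g := continuousOn_iff_continuous_domRestrict.mp hγ
  have ht : Continuous t := continuousOn_iff_continuous_domRestrict.mp hθ
  have g0 : g 0 = 0 := by simp [g, hγ0]
  have t0 : t 0 = 0 := by simp [t, hθ0]
  have t1 : t 1 = 2 * m * Real.pi := by simp [t, hturn]
  have ht1 : t 1 ≠ 0 := by
    rw [t1]; have := Real.pi_ne_zero
    have : (m : ℝ) ≠ 0 := by exact_mod_cast hm
    positivity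
  let G : I × I → ℂ := fun p =>
    Complex.exp (((t p.1 - t (p.2 * p.1) : ℝ) : ℂ) * Complex.I) * g (p.2 * p.1)
      + Complex.exp (((- t (p.2 * p.1) : ℝ) : ℂ) * Complex.I) * (g p.1 - g (p.2 * p.1))
      + (g 1 - g p.1)
  obtain ⟨⟨s, u⟩, hz⟩ := exists_zero_of_loop G (by fun_prop) (g 1) t ht t0 ht1
    (by intro u; simp [G, g0, t0]) (by intro u; simp [G, g0, t0]) (by intro u; simp [G])
    (by
      intro u
      have : Complex.exp (((t 1 - t u : ℝ) : ℂ) * Complex.I)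
          = Complex.exp (((- t u : ℝ) : ℂ) * Complex.I) := by
        rw [Complex.exp_eq_exp_iff_exists_int]
        refine ⟨m, ?_⟩
        rw [t1]; push_cast; ring
      simp only [G, mul_one, this]; ring)
  refine ⟨fun n => if n = 0 then 0 else if n = 1 then (u * s : I) else if n = 2 then s else 1,
    ⟨rfl, rfl, ?_⟩, ?_⟩
  · intro i hi
    interval_cases i
    · simpa using (u * s).2.1
    · simpa using mul_le_of_le_one_left s.2.1 u.2.2
    · simpa using s.2.2
  · simpa [G, g, t, hγ0] using hz

/-- For a non-closed `C¹` constant-speed curve `γ` with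
`γ(0) = 0`, turning angle `θ` with `θ(0) = 0` and `θ(1) − θ(0) = 2mπ`, `m ≠ 0`,
and a permutation `σ` of `{1,2,3}`: there exist cuts `C ∈ D_3` with
`e_σ(C) = 0` (i.e. `γ` is `(3,1)`-rearrangeable with respect to `σ`) iff `σ` is a
transposition. -/
theorem three_arc_rearrangeable_iff_transposition
    (γ : ℝ → ℂ) (θ : ℝ → ℝ) (cs : ℝ) (hcs : 0 < cs)
    (hγ0 : γ 0 = 0) (hnc : γ 1 ≠ γ 0) (hθ0 : θ 0 = 0)
    (hθ : ContinuousOn θ (Set.Icc 0 1))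
    (hderiv : ∀ s ∈ Set.Icc (0:ℝ) 1,
      HasDerivAt γ (cs • (⟨Real.cos (θ s), Real.sin (θ s)⟩ : ℂ)) s)
    (m : ℤ) (hm : m ≠ 0) (hturn : θ 1 - θ 0 = 2 * m * Real.pi)
    (σ : ℕ → ℕ) (hσ : Set.BijOn σ (Set.Icc 1 3) (Set.Icc 1 3)) :
    (∃ c : ℕ → ℝ, IsCuts 3 c ∧ rearrangedEnd 3 γ θ σ c = 0) ↔
    (∃ a b : ℕ, a ∈ Set.Icc 1 3 ∧ b ∈ Set.Icc 1 3 ∧ a ≠ b ∧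
      σ a = b ∧ σ b = a ∧ ∀ i ∈ Set.Icc 1 3, i ≠ a → i ≠ b → σ i = i) := by
  have hθ1 : θ 1 = 2 * m * Real.pi := by rw [← hturn, hθ0, sub_zero]
  have hγc : ContinuousOn γ (Set.Icc 0 1) :=
    fun s hs => (hderiv s hs).continuousAt.continuousWithinAt
  have hex := exists_cuts γ θ m hm hγ0 hθ0 hγc hθ hθ1
  have expand : ∀ c : ℕ → ℝ, rearrangedEnd 3 γ θ σ c =
      rot (- θ (c (σ 1 - 1))) (γ (c (σ 1)) - γ (c (σ 1 - 1)))
      + rot ((θ (c (σ 1)) - θ (c (σ 1 - 1))) - θ (c (σ 2 - 1))) (γ (c (σ 2)) - γ (c (σ 2 - 1)))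
      + rot ((θ (c (σ 1)) - θ (c (σ 1 - 1))) + (θ (c (σ 2)) - θ (c (σ 2 - 1))) - θ (c (σ 3 - 1)))
        (γ (c (σ 3)) - γ (c (σ 3 - 1))) := by
    intro c
    simp [rearrangedEnd, Finset.sum_Icc_succ_top]
    congr 1; ring
  have m1 := hσ.mapsTo (show 1 ∈ Set.Icc 1 3 by simp)
  have m2 := hσ.mapsTo (show 2 ∈ Set.Icc 1 3 by simp)
  have m3 := hσ.mapsTo (show 3 ∈ Set.Icc 1 3 by simp)
  have n12 : σ 1 ≠ σ 2 := fun h => by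
    have := hσ.injOn (show 1 ∈ Set.Icc 1 3 by simp) (show 2 ∈ Set.Icc 1 3 by simp) h
    omega
  have n13 : σ 1 ≠ σ 3 := fun h => by
    have := hσ.injOn (show 1 ∈ Set.Icc 1 3 by simp) (show 3 ∈ Set.Icc 1 3 by simp) h
    omega
  have n23 : σ 2 ≠ σ 3 := fun h => by
    have := hσ.injOn (show 2 ∈ Set.Icc 1 3 by simp) (show 3 ∈ Set.Icc 1 3 by simp) h
    omega
  rw [Set.mem_Icc] at m1 m2 m3
  have cases6 : (σ 1 = 1 ∧ σ 2 = 2 ∧ σ 3 = 3) ∨ (σ 1 = 2 ∧ σ 2 = 3 ∧ σ 3 = 1) ∨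
      (σ 1 = 3 ∧ σ 2 = 1 ∧ σ 3 = 2) ∨ (σ 1 = 2 ∧ σ 2 = 1 ∧ σ 3 = 3) ∨
      (σ 1 = 1 ∧ σ 2 = 3 ∧ σ 3 = 2) ∨ (σ 1 = 3 ∧ σ 2 = 2 ∧ σ 3 = 1) := by omega
  -- the non-transposition cases
  have neg : ∀ c : ℕ → ℝ, IsCuts 3 c → ∀ x : ℝ,
      rearrangedEnd 3 γ θ σ c = Complex.exp (x * Complex.I) * γ 1 →
      rearrangedEnd 3 γ θ σ c ≠ 0 := by
    intro c _ x hx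
    rw [hx]
    exact mul_ne_zero (Complex.exp_ne_zero _) (by rwa [hγ0] at hnc)
  have notT : (∃ a b : ℕ, a ∈ Set.Icc 1 3 ∧ b ∈ Set.Icc 1 3 ∧ a ≠ b ∧
      σ a = b ∧ σ b = a ∧ ∀ i ∈ Set.Icc 1 3, i ≠ a → i ≠ b → σ i = i) →
      ¬ ((σ 1 = 1 ∧ σ 2 = 2 ∧ σ 3 = 3) ∨ (σ 1 = 2 ∧ σ 2 = 3 ∧ σ 3 = 1) ∨
      (σ 1 = 3 ∧ σ 2 = 1 ∧ σ 3 = 2)) := by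
    rintro ⟨a, b, ⟨ha, ha'⟩, ⟨hb, hb'⟩, hab, h1, h2, -⟩
    interval_cases a <;> interval_cases b <;> omega
  have i3 : ∀ (a b : ℕ), (σ 1 = 1 ∨ 1 = a ∨ 1 = b) → (σ 2 = 2 ∨ 2 = a ∨ 2 = b) →
      (σ 3 = 3 ∨ 3 = a ∨ 3 = b) → ∀ i ∈ Set.Icc 1 3, i ≠ a → i ≠ b → σ i = i := by
    rintro a b h1 h2 h3 i ⟨hi, hi'⟩ hia hib
    interval_cases i <;> omega
  rcases cases6 with h | h | h | h | h | h
  · refine iff_of_false ?_ (fun H => notT H (by omega))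
    rintro ⟨c, hc, hz⟩
    refine neg c hc 0 ?_ hz
    obtain ⟨c0, c3, -⟩ := hc
    rw [expand, h.1, h.2.1, h.2.2]
    simp only [Nat.sub_self, Nat.reduceSub, c0, c3, hγ0, hθ0]
    rw [rot_eq_exp m _ 0 0 (by push_cast; ring), rot_eq_exp m _ 0 0 (by push_cast; ring),
      rot_eq_exp m _ 0 0 (by push_cast; ring)]
    ring
  · refine iff_of_false ?_ (fun H => notT H (by omega))
    rintro ⟨c, hc, hz⟩
    refine neg c hc (-θ (c 1)) ?_ hz
    obtain ⟨c0, c3, -⟩ := hc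
    rw [expand, h.1, h.2.1, h.2.2]
    simp only [Nat.sub_self, Nat.reduceSub, c0, c3, hγ0, hθ0, hθ1]
    rw [rot_eq_exp m _ (-θ (c 1)) 0 (by push_cast; ring),
      rot_eq_exp m _ (-θ (c 1)) 0 (by push_cast; ring),
      rot_eq_exp m _ (-θ (c 1)) 1 (by push_cast; ring)]
    ring
  · refine iff_of_false ?_ (fun H => notT H (by omega))
    rintro ⟨c, hc, hz⟩
    refine neg c hc (-θ (c 2)) ?_ hz
    obtain ⟨c0, c3, -⟩ := hc
    rw [expand, h.1, h.2.1, h.2.2]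
    simp only [Nat.sub_self, Nat.reduceSub, c0, c3, hγ0, hθ0, hθ1]
    rw [rot_eq_exp m _ (-θ (c 2)) 0 (by push_cast; ring),
      rot_eq_exp m _ (-θ (c 2)) 1 (by push_cast; ring),
      rot_eq_exp m _ (-θ (c 2)) 1 (by push_cast; ring)]
    ring
  · refine iff_of_true ?_ ⟨1, 2, by simp, by simp, by simp, h.1, h.2.1,
      i3 _ _ (by omega) (by omega) (by omega)⟩
    obtain ⟨c, hc, hz⟩ := hex
    refine ⟨c, hc, ?_⟩
    obtain ⟨c0, c3, -⟩ := hc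
    rw [expand, h.1, h.2.1, h.2.2]
    simp only [Nat.sub_self, Nat.reduceSub, c0, c3, hγ0, hθ0, hθ1] at hz ⊢
    rw [rot_eq_exp m _ (-θ (c 1)) 0 (by push_cast; ring),
      rot_eq_exp m _ (θ (c 2) - θ (c 1)) 0 (by push_cast; ring),
      rot_eq_exp m _ 0 0 (by push_cast; ring)]
    simp only [Complex.ofReal_zero, zero_mul, Complex.exp_zero]
    linear_combination hz
  · refine iff_of_true ?_ ⟨2, 3, by simp, by simp, by simp, h.2.1, h.2.2,
      i3 _ _ (by omega) (by omega) (by omega)⟩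
    obtain ⟨c, hc, hz⟩ := hex
    refine ⟨c, hc, ?_⟩
    obtain ⟨c0, c3, -⟩ := hc
    rw [expand, h.1, h.2.1, h.2.2]
    simp only [Nat.sub_self, Nat.reduceSub, c0, c3, hγ0, hθ0, hθ1] at hz ⊢
    rw [rot_eq_exp m _ ((θ (c 1) - θ (c 2)) + (θ (c 2) - θ (c 1))) 0 (by push_cast; ring),
      rot_eq_exp m _ (θ (c 1) - θ (c 2)) 0 (by push_cast; ring),
      rot_eq_exp m _ ((θ (c 1) - θ (c 2)) + (-θ (c 1))) 1 (by push_cast; ring)]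
    simp only [Complex.ofReal_add (θ (c 1) - θ (c 2)), add_mul, Complex.exp_add]
    linear_combination Complex.exp (((θ (c 1) - θ (c 2) : ℝ) : ℂ) * Complex.I) * hz
  · refine iff_of_true ?_ ⟨1, 3, by simp, by simp, by simp, h.1, h.2.2,
      i3 _ _ (by omega) (by omega) (by omega)⟩
    obtain ⟨c, hc, hz⟩ := hex
    refine ⟨c, hc, ?_⟩
    obtain ⟨c0, c3, -⟩ := hc
    rw [expand, h.1, h.2.1, h.2.2]
    simp only [Nat.sub_self, Nat.reduceSub, c0, c3, hγ0, hθ0, hθ1] at hz ⊢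
    rw [rot_eq_exp m _ (-θ (c 2)) 0 (by push_cast; ring),
      rot_eq_exp m _ (-θ (c 2) + (-θ (c 1))) 1 (by push_cast; ring),
      rot_eq_exp m _ (-θ (c 2) + (θ (c 2) - θ (c 1))) 1 (by push_cast; ring)]
    simp only [Complex.ofReal_add (-θ (c 2)), add_mul, Complex.exp_add]
    linear_combination Complex.exp (((-θ (c 2) : ℝ) : ℂ) * Complex.I) * hz
end

section
/- Let k ≥ 4 and let σ ∈ S_k be a permutation of {1,…,k} that is not a cyclic shift (σ ∉ Z_k) and satisfies σ(1) = 1. Then there exists i ∈ {1,…,k} such that the induced permutation F_i(σ) ∈ S_{k−1} is not a cyclic shift, i.e., F_i(σ) ∈ S_{k−1} \ Z_{k−1}. -/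
/-- The contracted permutation `F_i(σ)` of `{1,…,k−1}` obtained from a
permutation `σ` of `{1,…,k}` by deleting position `i` and relabelling:
`F_i(σ)(j) = σ(j)` if `j < i, σ(j) < σ(i)`; `σ(j) − 1` if `j < i, σ(j) > σ(i)`;
`σ(j+1)` if `j ≥ i, σ(j+1) < σ(i)`; `σ(j+1) − 1` if `j ≥ i, σ(j+1) > σ(i)`. -/
def contractPerm (σ : ℕ → ℕ) (i : ℕ) (j : ℕ) : ℕ :=
  if j < i then (if σ j < σ i then σ j else σ j - 1)
  else (if σ (j + 1) < σ i then σ (j + 1) else σ (j + 1) - 1)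

/-- If `k ≥ 4` and `σ` is a permutation of `{1,…,k}` which is
not a cyclic shift and satisfies `σ(1) = 1`, then there is an index
`i ∈ {1,…,k}` such that the contracted permutation `F_i(σ)` of `{1,…,k−1}` is
not a cyclic shift either. -/
theorem exists_contraction_not_cyclic_shift
    (k : ℕ) (hk : 4 ≤ k) (σ : ℕ → ℕ)
    (hσ : Set.BijOn σ (Set.Icc 1 k) (Set.Icc 1 k))
    (hσ1 : σ 1 = 1)
    (hnotZ : ¬ IsCyclicShiftOn k σ) :
    ∃ i ∈ Set.Icc 1 k, ¬ IsCyclicShiftOn (k - 1) (contractPerm σ i) := by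
  by_contra hcon
  push Not at hcon
  have hgt : ∀ i, 2 ≤ i → i ≤ k → 1 < σ i := by
    intro i h2 hik
    have h1 := (hσ.mapsTo (show i ∈ Set.Icc 1 k from ⟨by omega, hik⟩)).1
    have hne : σ i ≠ σ 1 := fun h => by
      have := hσ.injOn (show i ∈ Set.Icc 1 k from ⟨by omega, hik⟩)
        (show 1 ∈ Set.Icc 1 k from ⟨by omega, by omega⟩) h
      omega
    omega
  have hid : ∀ i, 2 ≤ i → i ≤ k → ∀ j, 1 ≤ j → j ≤ k - 1 → contractPerm σ i j = j := by
    intro i h2 hik j hj1 hjk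
    obtain ⟨h, hh, hs⟩ := hcon i ⟨by omega, hik⟩
    have e1 := hs 1 ⟨by omega, by omega⟩
    have hg := hgt i h2 hik
    have e2 : contractPerm σ i 1 = 1 := by
      unfold contractPerm
      rw [if_pos (by omega), if_pos (by omega), hσ1]
    rw [e2, if_pos (by omega)] at e1
    have e3 := hs j ⟨hj1, hjk⟩
    rw [if_pos (by omega)] at e3
    omega
  have hA : ∀ j, 2 ≤ j → j < k → σ j = j ∨ σ j = j + 1 := by
    intro j h2 hjk
    have := hid k (by omega) le_rfl j (by omega) (by omega)
    unfold contractPerm at this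
    rw [if_pos hjk] at this
    split_ifs at this <;> omega
  have hB : ∀ j, 3 ≤ j → j ≤ k → (σ j < σ 2 ∧ σ j = j - 1) ∨ σ j = j := by
    intro j h3 hjk
    have := hid 2 (by omega) (by omega) (j - 1) (by omega) (by omega)
    unfold contractPerm at this
    rw [if_neg (by omega), show j - 1 + 1 = j by omega] at this
    split_ifs at this <;> omega
  have h3 : σ 3 = 3 := by
    have := hA 3 (by omega) (by omega)
    have := hB 3 (by omega) (by omega)
    omega
  have h2 : σ 2 = 2 := by
    have := hA 2 (by omega) (by omega)
    have hne : σ 2 ≠ σ 3 := fun h => by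
      have := hσ.injOn (show 2 ∈ Set.Icc 1 k from ⟨by omega, by omega⟩)
        (show 3 ∈ Set.Icc 1 k from ⟨by omega, by omega⟩) h
      omega
    omega
  apply hnotZ
  refine ⟨0, by omega, ?_⟩
  rintro i ⟨hi1, hik⟩
  rw [if_pos (by omega)]
  rcases (by omega : i = 1 ∨ i = 2 ∨ 3 ≤ i) with rfl | rfl | h
  · exact hσ1
  · exact h2
  · have := hB i h hik
    omega
end

section
/- Let γ : [0,1] → ℝ² be a C¹ constant speed non-closed planar curve (γ(1) ≠ γ(0)) with γ(0) = (0,0), and θ a turning angle function with θ(0) = 0 and θ(1) − θ(0) = 2mπ for a nonzero integer m. Let k ≥ 4 and σ ∈ S_k. Then there exist cuts C in the boundary ∂D_k of D_k (i.e., C with at least one equality among 0 = c₀ ≤ c₁ ≤ … ≤ c_{k−1} ≤ c_k = 1) such that e_σ(C) = (0,0), i.e., the rearranged curve r_{σ,C} is a closed C¹ curve, if and only if σ is not a cyclic shift (σ ∈ S_k \ Z_k). -/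
open unitInterval in
theorem aux_top (g : ℝ → ℂ) (θ : ℝ → ℝ) (hg : Continuous g) (hθ : Continuous θ)
    (hg0 : g 0 = 0) (hg1 : g 1 ≠ 0) (hθ0 : θ 0 = 0) (m : ℤ) (hm : m ≠ 0)
    (hθ1 : θ 1 = 2 * m * Real.pi) :
    ∃ s t : ℝ, 0 ≤ s ∧ s ≤ t ∧ t ≤ 1 ∧
      Complex.exp (θ t * Complex.I) * g s + Complex.exp (θ s * Complex.I) * (g 1 - g t)
        + (g t - g s) = 0 := by
  by_contra hcon
  push Not at hcon
  have hE1 : Complex.exp (θ 1 * Complex.I) = 1 := by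
    rw [Complex.exp_eq_one_iff]
    exact ⟨m, by rw [hθ1]; push_cast; ring⟩
  let F : ℝ → ℝ → ℂ := fun s t =>
    Complex.exp (θ t * Complex.I) * g s + Complex.exp (θ s * Complex.I) * (g 1 - g t)
        + (g t - g s)
  have hdom : ∀ τ s : I, F s (s + τ * (1 - s)) ≠ 0 := by
    intro τ s
    have h1 := τ.2.1
    have h2 := τ.2.2
    have h3 := s.2.1
    have h4 := s.2.2
    exact hcon _ _ h3 (by nlinarith) (by nlinarith)
  have hFdiag : ∀ s, F s s = Complex.exp (θ s * Complex.I) * g 1 := by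
    intro s; simp only [F]; ring
  have hF1 : ∀ s, F s 1 = g 1 := by
    intro s; simp only [F, hE1]; ring
  have hF0 : ∀ t, F 0 t = g 1 := by
    intro t; simp [F, hg0, hθ0]
  let X := {z : ℂ // z ≠ 0}
  let γ₀ : C(I, X) := ⟨fun s => ⟨Complex.exp (θ s * Complex.I) * g 1,
    mul_ne_zero (Complex.exp_ne_zero _) hg1⟩, by
      apply Continuous.subtype_mk; fun_prop⟩
  let γ₁ : C(I, X) := ContinuousMap.const I ⟨g 1, hg1⟩
  have hcont : Continuous fun p : I × I => F p.2 (p.2 + p.1 * (1 - p.2)) := by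
    simp only [F]; fun_prop
  have H : γ₀.HomotopicRel γ₁ {0, 1} := by
    refine ⟨⟨⟨⟨fun p => ⟨F p.2 (p.2 + p.1 * (1 - p.2)), hdom _ _⟩,
      hcont.subtype_mk _⟩, ?_, ?_⟩, ?_⟩⟩
    · intro s
      apply Subtype.ext
      simp [γ₀, hFdiag]
    · intro s
      apply Subtype.ext
      simp [γ₁, hF1]
    · intro τ s hs
      apply Subtype.ext
      rcases hs with rfl | hs
      · simp [γ₀, hF0, hθ0]
      · rw [Set.mem_singleton_iff] at hs
        subst hs
        simp [γ₀, hF1, hE1]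
  have cov := Complex.isCoveringMap_exp
  have e0 : γ₀ 0 = (⟨_, (Complex.log (g 1)).exp_ne_zero⟩ : X) := by
    apply Subtype.ext
    simp [γ₀, hθ0, Complex.exp_log hg1]
  have e1 : γ₁ 0 = (⟨_, (Complex.log (g 1)).exp_ne_zero⟩ : X) := by
    apply Subtype.ext
    simp [γ₁, Complex.exp_log hg1]
  have key := cov.liftPath_apply_one_eq_of_homotopicRel H (Complex.log (g 1)) e0 e1
  let Γ₀ : C(I, ℂ) := ⟨fun s => θ s * Complex.I + Complex.log (g 1), by fun_prop⟩
  have l0 : Γ₀ = cov.liftPath γ₀ (Complex.log (g 1)) e0 := by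
    rw [cov.eq_liftPath_iff']
    constructor
    · funext s
      apply Subtype.ext
      simp [Γ₀, γ₀, Complex.exp_add, Complex.exp_log hg1]
    · simp [Γ₀, hθ0]
  have l1 : ContinuousMap.const I (Complex.log (g 1)) =
      cov.liftPath γ₁ (Complex.log (g 1)) e1 := by
    rw [cov.eq_liftPath_iff']
    constructor
    · funext s
      apply Subtype.ext
      simp [γ₁, Complex.exp_log hg1]
    · simp
  rw [← l0, ← l1] at key
  simp [Γ₀, hθ1, hm, Real.pi_ne_zero] at key

theorem aux_cyc {G : Type*} [AddCommGroup G] (k h : ℕ) (hh : h < k) (σ : ℕ → ℕ)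
    (hs : ∀ i ∈ Set.Icc 1 k, σ i = if i ≤ k - h then i + h else i + h - k) (g : ℕ → G) :
    ∀ n ≤ k, ∑ j ∈ Finset.Icc 1 n, (g (σ j) - g (σ j - 1)) =
      if n ≤ k - h then g (n + h) - g h else g (n + h - k) - g 0 + (g k - g h) := by
  intro n
  induction n with
  | zero => intro _; simp
  | succ n ih =>
    intro hn
    rw [Finset.sum_Icc_succ_top (by omega), ih (by omega), hs (n + 1) ⟨by omega, hn⟩]
    by_cases h1 : n + 1 ≤ k - h
    · rw [if_pos (by omega), if_pos h1, if_pos h1]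
      have : n + 1 + h - 1 = n + h := by omega
      rw [this]; abel
    · rw [if_neg h1, if_neg h1]
      have : n + 1 + h - k - 1 = n + h - k := by omega
      rw [this]
      by_cases h2 : n ≤ k - h
      · rw [if_pos h2]
        have h3 : n + h = k := by omega
        rw [h3, Nat.sub_self]; abel
      · rw [if_neg h2]; abel

theorem aux_comb (k : ℕ) (hk : 1 ≤ k) (σ : ℕ → ℕ)
    (hσ : Set.BijOn σ (Set.Icc 1 k) (Set.Icc 1 k))
    (hno : ∀ p q r, 1 ≤ p → p < q → q < r → r ≤ k →
      ¬ ((σ p < σ r ∧ σ r < σ q) ∨ (σ q < σ p ∧ σ p < σ r) ∨ (σ r < σ q ∧ σ q < σ p))) :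
    IsCyclicShiftOn k σ := by
  have hm : ∀ i, 1 ≤ i → i ≤ k → 1 ≤ σ i ∧ σ i ≤ k := fun i h1 h2 => hσ.mapsTo ⟨h1, h2⟩
  have hinj : ∀ i j, 1 ≤ i → i < j → j ≤ k → σ i ≠ σ j := by
    intro i j h1 h2 h3 h4
    have := hσ.injOn (⟨h1, by omega⟩ : i ∈ Set.Icc 1 k) ⟨by omega, h3⟩ h4
    omega
  let τ : ℕ → ℕ := fun i => if σ 1 ≤ σ i then σ i - σ 1 else σ i + k - σ 1
  have h1 := hm 1 le_rfl hk
  have hmono : ∀ i, 1 ≤ i → i + 1 ≤ k → τ i < τ (i + 1) := by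
    intro i hi hik
    have a1 := hm i hi (by omega)
    have a2 := hm (i + 1) (by omega) hik
    have a3 := hinj i (i + 1) hi (by omega) hik
    have a4 := hinj 1 (i + 1) le_rfl (by omega) hik
    simp only [τ]
    rcases Nat.eq_or_lt_of_le hi with rfl | hlt
    · split_ifs <;> omega
    · have a5 := hinj 1 i le_rfl hlt (by omega)
      have a6 := hno 1 i (i + 1) le_rfl hlt (by omega) hik
      split_ifs <;> omega
  have hlow : ∀ i, 1 ≤ i → i ≤ k → i - 1 ≤ τ i := by
    intro i hi
    induction i, hi using Nat.le_induction with
    | base => intro _; omega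
    | succ i hi ih =>
      intro hik
      have := hmono i hi hik
      have := ih (by omega)
      omega
  have hup : ∀ d, d < k → τ (k - d) + d ≤ k - 1 := by
    intro d
    induction d with
    | zero =>
      intro _
      have := hm k hk le_rfl
      simp only [τ, Nat.sub_zero]
      split_ifs <;> omega
    | succ d ih =>
      intro hd
      have a := ih (by omega)
      have b := hmono (k - (d + 1)) (by omega) (by omega)
      have c : k - (d + 1) + 1 = k - d := by omega
      rw [c] at b
      omega
  refine ⟨σ 1 - 1, by omega, ?_⟩
  rintro i ⟨hi, hik⟩
  have a := hlow i hi hik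
  have b := hup (k - i) (by omega)
  have c : k - (k - i) = i := by omega
  rw [c] at b
  have d := hm i hi hik
  have e : τ i = i - 1 := by omega
  simp only [τ] at e
  split_ifs at e ⊢ <;> omega

theorem aux_sum3 {G : Type*} [AddCommGroup G] (f : ℕ → G) (p q r : ℕ) (hp : 1 ≤ p)
    (hpq : p < q) (hqr : q < r) (n : ℕ)
    (hf : ∀ i ∈ Finset.Icc 1 n, i ≠ p → i ≠ q → i ≠ r → f i = 0) :
    ∑ i ∈ Finset.Icc 1 n, f i =
      (if p ≤ n then f p else 0) + (if q ≤ n then f q else 0) + (if r ≤ n then f r else 0) := by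
  induction n with
  | zero =>
    rw [if_neg (by omega), if_neg (by omega), if_neg (by omega)]; simp
  | succ n ih =>
    rw [Finset.sum_Icc_succ_top (by omega), ih (fun i hi => hf i (by
      simp only [Finset.mem_Icc] at hi ⊢; omega))]
    have h := hf (n + 1) (by simp)
    by_cases h1 : n + 1 = p
    · subst h1
      rw [if_neg (by omega), if_neg (by omega), if_neg (by omega), if_pos (by omega),
        if_neg (by omega), if_neg (by omega)]; abel
    by_cases h2 : n + 1 = q
    · subst h2
      rw [if_pos (by omega), if_neg (by omega), if_neg (by omega), if_pos (by omega),
        if_pos (by omega), if_neg (by omega)]; abel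
    by_cases h3 : n + 1 = r
    · subst h3
      rw [if_pos (by omega), if_pos (by omega), if_neg (by omega), if_pos (by omega),
        if_pos (by omega), if_pos (by omega)]; abel
    rw [h h1 h2 h3, add_zero]
    have e1 : p ≤ n + 1 ↔ p ≤ n := by omega
    have e2 : q ≤ n + 1 ↔ q ≤ n := by omega
    have e3 : r ≤ n + 1 ↔ r ≤ n := by omega
    simp only [e1, e2, e3]

theorem aux_end3 (k : ℕ) (γ : ℝ → ℂ) (θ : ℝ → ℝ) (σ : ℕ → ℕ) (c : ℕ → ℝ) (p q r : ℕ)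
    (hp : 1 ≤ p) (hpq : p < q) (hqr : q < r) (hr : r ≤ k)
    (hc : ∀ i, 1 ≤ i → i ≤ k → i ≠ p → i ≠ q → i ≠ r → c (σ i) = c (σ i - 1)) :
    rearrangedEnd k γ θ σ c =
      rot (- θ (c (σ p - 1))) (γ (c (σ p)) - γ (c (σ p - 1)))
      + rot (θ (c (σ p)) - θ (c (σ p - 1)) - θ (c (σ q - 1))) (γ (c (σ q)) - γ (c (σ q - 1)))
      + rot (θ (c (σ p)) - θ (c (σ p - 1)) + (θ (c (σ q)) - θ (c (σ q - 1)))
          - θ (c (σ r - 1))) (γ (c (σ r)) - γ (c (σ r - 1))) := by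
  unfold rearrangedEnd
  have hin : ∀ n ≤ k, ∀ i ∈ Finset.Icc 1 n, i ≠ p → i ≠ q → i ≠ r →
      θ (c (σ i)) - θ (c (σ i - 1)) = 0 := by
    intro n hn i hi h1 h2 h3
    rw [Finset.mem_Icc] at hi
    rw [hc i hi.1 (by omega) h1 h2 h3, sub_self]
  rw [aux_sum3 _ p q r hp hpq hqr k, if_pos (by omega), if_pos (by omega), if_pos hr,
    aux_sum3 _ p q r hp hpq hqr (p - 1) (hin _ (by omega)),
    aux_sum3 _ p q r hp hpq hqr (q - 1) (hin _ (by omega)),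
    aux_sum3 _ p q r hp hpq hqr (r - 1) (hin _ (by omega))]
  · rw [if_neg (by omega), if_neg (by omega), if_neg (by omega), if_pos (by omega),
      if_neg (by omega), if_neg (by omega), if_pos (by omega), if_pos (by omega),
      if_neg (by omega)]
    simp
  · intro i hi h1 h2 h3
    rw [Finset.mem_Icc] at hi
    rw [hc i hi.1 hi.2 h1 h2 h3, sub_self]
    simp [rot_eq]

/-- Cuts leaving only the pieces `x < y < z` nonempty. -/
noncomputable def cuts3 (x y z : ℕ) (s t : ℝ) (i : ℕ) : ℝ :=
  if i < x then 0 else if i < y then s else if i < z then t else 1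

theorem cuts3_spec (k x y z : ℕ) (s t : ℝ) (hx : 1 ≤ x) (hxy : x < y) (hyz : y < z) (hz : z ≤ k)
    (hs : 0 ≤ s) (hst : s ≤ t) (ht : t ≤ 1) (hk : 4 ≤ k) :
    IsCuts k (cuts3 x y z s t) ∧ (∃ i < k, cuts3 x y z s t i = cuts3 x y z s t (i + 1)) ∧
    cuts3 x y z s t (x - 1) = 0 ∧ cuts3 x y z s t x = s ∧ cuts3 x y z s t (y - 1) = s ∧
    cuts3 x y z s t y = t ∧ cuts3 x y z s t (z - 1) = t ∧ cuts3 x y z s t z = 1 ∧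
    ∀ i, 1 ≤ i → i ≠ x → i ≠ y → i ≠ z → cuts3 x y z s t i = cuts3 x y z s t (i - 1) := by
  have hlast : ∀ i, 1 ≤ i → i ≠ x → i ≠ y → i ≠ z →
      cuts3 x y z s t i = cuts3 x y z s t (i - 1) := by
    intro i h1 h2 h3 h4
    have e1 : i < x ↔ i - 1 < x := by omega
    have e2 : i < y ↔ i - 1 < y := by omega
    have e3 : i < z ↔ i - 1 < z := by omega
    simp only [cuts3, e1, e2, e3]
  refine ⟨⟨?_, ?_, ?_⟩, ?_, ?_, ?_, ?_, ?_, ?_, ?_, hlast⟩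
  · simp only [cuts3]; rw [if_pos (by omega)]
  · simp only [cuts3]; rw [if_neg (by omega), if_neg (by omega), if_neg (by omega)]
  · intro i _
    simp only [cuts3]
    split_ifs <;> first | omega | linarith
  · obtain ⟨i, h1, h2, h3, h4, h5⟩ :
        ∃ i, 1 ≤ i ∧ i ≤ k ∧ i ≠ x ∧ i ≠ y ∧ i ≠ z := by
      by_contra hcon
      push Not at hcon
      have a1 := hcon 1
      have a2 := hcon 2
      have a3 := hcon 3
      have a4 := hcon 4
      omega
    refine ⟨i - 1, by omega, ?_⟩
    rw [Nat.sub_add_cancel h1]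
    exact (hlast i h1 h3 h4 h5).symm
  · simp only [cuts3]; rw [if_pos (by omega)]
  · simp only [cuts3]; rw [if_neg (by omega), if_pos (by omega)]
  · simp only [cuts3]; rw [if_neg (by omega), if_pos (by omega)]
  · simp only [cuts3]; rw [if_neg (by omega), if_neg (by omega), if_pos (by omega)]
  · simp only [cuts3]; rw [if_neg (by omega), if_neg (by omega), if_pos (by omega)]
  · simp only [cuts3]; rw [if_neg (by omega), if_neg (by omega), if_neg (by omega)]

/-- For a non-closed `C¹` constant-speed curve `γ` with
`γ(0) = 0`, turning angle `θ` with `θ(0) = 0` and `θ(1) − θ(0) = 2mπ`, `m ≠ 0`,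
`k ≥ 4` and a permutation `σ` of `{1,…,k}`: there exist cuts `C ∈ ∂D_k` (some
consecutive cuts coincide, including the conventions `c₀ = 0`, `c_k = 1`) with
`e_σ(C) = 0`, i.e. the rearranged curve `r_{σ,C}` is a closed `C¹` curve, iff `σ`
is not a cyclic shift. -/
theorem boundary_rearrangeable_iff_not_cyclic_shift
    (γ : ℝ → ℂ) (θ : ℝ → ℝ) (cs : ℝ) (hcs : 0 < cs)
    (hγ0 : γ 0 = 0) (hnc : γ 1 ≠ γ 0) (hθ0 : θ 0 = 0)
    (hθ : ContinuousOn θ (Set.Icc 0 1))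
    (hderiv : ∀ s ∈ Set.Icc (0:ℝ) 1,
      HasDerivAt γ (cs • (⟨Real.cos (θ s), Real.sin (θ s)⟩ : ℂ)) s)
    (m : ℤ) (hm : m ≠ 0) (hturn : θ 1 - θ 0 = 2 * m * Real.pi)
    (k : ℕ) (hk : 4 ≤ k) (σ : ℕ → ℕ)
    (hσ : Set.BijOn σ (Set.Icc 1 k) (Set.Icc 1 k)) :
    (∃ c : ℕ → ℝ, IsCuts k c ∧ (∃ i < k, c i = c (i + 1)) ∧
      rearrangedEnd k γ θ σ c = 0) ↔
    ¬ IsCyclicShiftOn k σ := by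
  have hθ1 : θ 1 = 2 * m * Real.pi := by linarith
  have hE1 : Complex.exp (θ 1 * Complex.I) = 1 := by
    rw [Complex.exp_eq_one_iff]
    exact ⟨m, by rw [hθ1]; push_cast; ring⟩
  have hw : γ 1 ≠ 0 := by rwa [hγ0] at hnc
  constructor
  · rintro ⟨c, ⟨hc0, hck, -⟩, -, hend⟩ ⟨h, hh, hs⟩
    have key : rearrangedEnd k γ θ σ c = Complex.exp (-θ (c h) * Complex.I) *
        ∑ i ∈ Finset.Icc 1 k, (γ (c (σ i)) - γ (c (σ i - 1))) := by
      rw [Finset.mul_sum]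
      unfold rearrangedEnd
      apply Finset.sum_congr rfl
      intro i hi
      rw [Finset.mem_Icc] at hi
      rw [rot_eq, aux_cyc k h hh σ hs (fun j => θ (c j)) (i - 1) (by omega),
        hs i ⟨hi.1, hi.2⟩]
      congr 1
      by_cases h1 : i ≤ k - h
      · rw [if_pos h1, if_pos (by omega)]
        have : i + h - 1 = i - 1 + h := by omega
        rw [this]
        congr 1
        push_cast
        ring
      · rw [if_neg h1]
        by_cases h2 : i - 1 ≤ k - h
        · rw [if_pos h2]
          have e1 : i + h - k - 1 = 0 := by omega
          have e2 : i - 1 + h = k := by omega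
          rw [e1, e2, hc0, hck, hθ0]
          rw [show ((θ 1 - θ (c h) - 0 : ℝ) : ℂ) * Complex.I =
            -θ (c h) * Complex.I + θ 1 * Complex.I by push_cast; ring, Complex.exp_add, hE1,
            mul_one]
        · rw [if_neg h2]
          have e1 : i + h - k - 1 = i - 1 + h - k := by omega
          rw [e1, hc0, hck, hθ0]
          rw [show ((θ (c (i - 1 + h - k)) - 0 + (θ 1 - θ (c h)) - θ (c (i - 1 + h - k)) : ℝ) : ℂ)
            * Complex.I = -θ (c h) * Complex.I + θ 1 * Complex.I by push_cast; ring,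
            Complex.exp_add, hE1, mul_one]
    have hsum := aux_cyc k h hh σ hs (fun j => γ (c j)) k le_rfl
    have hsum2 : ∑ i ∈ Finset.Icc 1 k, (γ (c (σ i)) - γ (c (σ i - 1))) = γ 1 := by
      rw [hsum]
      by_cases h0 : h = 0
      · subst h0
        rw [if_pos (by omega), Nat.add_zero, hck, hc0, hγ0, sub_zero]
      · rw [if_neg (by omega), Nat.add_sub_cancel_left, hck, hc0, hγ0]; ring
    rw [key, hsum2] at hend
    exact mul_ne_zero (Complex.exp_ne_zero _) hw hend
  · intro hnot
    have hγc : ContinuousOn γ (Set.Icc 0 1) :=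
      fun s hs => (hderiv s hs).continuousAt.continuousWithinAt
    obtain ⟨s, t, hs0, hst, ht1, hF⟩ : ∃ s t : ℝ, 0 ≤ s ∧ s ≤ t ∧ t ≤ 1 ∧
      Complex.exp (θ t * Complex.I) * γ s + Complex.exp (θ s * Complex.I) * (γ 1 - γ t)
        + (γ t - γ s) = 0 := by
      have z1 : (0:ℝ) ≤ 1 := zero_le_one
      have eg : ∀ x ∈ Set.Icc (0:ℝ) 1, Set.IccExtend z1 ((Set.Icc (0:ℝ) 1).domRestrict γ) x = γ x :=
        fun x hx => by rw [Set.IccExtend_of_mem _ _ hx]; rfl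
      have et : ∀ x ∈ Set.Icc (0:ℝ) 1, Set.IccExtend z1 ((Set.Icc (0:ℝ) 1).domRestrict θ) x = θ x :=
        fun x hx => by rw [Set.IccExtend_of_mem _ _ hx]; rfl
      have m0 : (0:ℝ) ∈ Set.Icc (0:ℝ) 1 := ⟨le_rfl, z1⟩
      have m1 : (1:ℝ) ∈ Set.Icc (0:ℝ) 1 := ⟨z1, le_rfl⟩
      obtain ⟨s, t, h1, h2, h3, h4⟩ := aux_top (Set.IccExtend z1 ((Set.Icc (0:ℝ) 1).domRestrict γ))
        (Set.IccExtend z1 ((Set.Icc (0:ℝ) 1).domRestrict θ))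
        (continuousOn_iff_continuous_domRestrict.1 hγc).Icc_extend'
        (continuousOn_iff_continuous_domRestrict.1 hθ).Icc_extend'
        (by rw [eg 0 m0, hγ0]) (by rw [eg 1 m1]; exact hw) (by rw [et 0 m0, hθ0]) m hm
        (by rw [et 1 m1, hθ1])
      refine ⟨s, t, h1, h2, h3, ?_⟩
      rwa [eg 1 m1, eg s ⟨h1, h2.trans h3⟩, eg t ⟨h1.trans h2, h3⟩, et s ⟨h1, h2.trans h3⟩,
        et t ⟨h1.trans h2, h3⟩] at h4
    obtain ⟨p, q, r, hp, hpq, hqr, hr, hbad⟩ : ∃ p q r, 1 ≤ p ∧ p < q ∧ q < r ∧ r ≤ k ∧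
        ((σ p < σ r ∧ σ r < σ q) ∨ (σ q < σ p ∧ σ p < σ r) ∨ (σ r < σ q ∧ σ q < σ p)) := by
      by_contra hcon
      push Not at hcon
      apply hnot
      apply aux_comb k (by omega) σ hσ
      intro p q r h1 h2 h3 h4
      have := hcon p q r h1 h2 h3 h4
      omega
    have hmaps : ∀ i, 1 ≤ i → i ≤ k → 1 ≤ σ i ∧ σ i ≤ k := fun i h1 h2 => hσ.mapsTo ⟨h1, h2⟩
    have hinj : ∀ i j, 1 ≤ i → i ≤ k → 1 ≤ j → j ≤ k → i ≠ j → σ i ≠ σ j := by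
      intro i j h1 h2 h3 h4 h5 h6
      exact h5 (hσ.injOn ⟨h1, h2⟩ ⟨h3, h4⟩ h6)
    have mp := hmaps p hp (by omega)
    have mq := hmaps q (by omega) (by omega)
    have mr := hmaps r (by omega) hr
    have hne : ∀ i, 1 ≤ i → i ≤ k → i ≠ p → i ≠ q → i ≠ r →
        1 ≤ σ i ∧ σ i ≠ σ p ∧ σ i ≠ σ q ∧ σ i ≠ σ r := by
      intro i h1 h2 h3 h4 h5
      exact ⟨(hmaps i h1 h2).1, hinj i p h1 h2 hp (by omega) h3,
        hinj i q h1 h2 (by omega) (by omega) h4, hinj i r h1 h2 (by omega) hr h5⟩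
    have ns := Complex.exp_ne_zero (θ s * Complex.I)
    have nt := Complex.exp_ne_zero (θ t * Complex.I)
    rcases hbad with ⟨b1, b2⟩ | ⟨b1, b2⟩ | ⟨b1, b2⟩
    · obtain ⟨hC, hB, v1, v2, v3, v4, v5, v6, v7⟩ := cuts3_spec k (σ p) (σ r) (σ q) s t
        mp.1 b1 b2 mq.2 hs0 hst ht1 hk
      refine ⟨_, hC, hB, ?_⟩
      rw [aux_end3 k γ θ σ _ p q r hp hpq hqr hr, v1, v2, v3, v4, v5, v6]
      · simp only [rot_eq, hθ0, hγ0]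
        push_cast
        simp only [sub_mul, add_mul, neg_mul, Complex.exp_add, Complex.exp_sub, Complex.exp_neg,
          hE1, zero_mul, Complex.exp_zero]
        generalize Complex.exp (θ s * Complex.I) = a at *
        generalize Complex.exp (θ t * Complex.I) = b at *
        field_simp
        linear_combination hF
      · intro i h1 h2 h3 h4 h5
        obtain ⟨a, b, c, d⟩ := hne i h1 h2 h3 h4 h5
        exact v7 _ a b d c
    · obtain ⟨hC, hB, v1, v2, v3, v4, v5, v6, v7⟩ := cuts3_spec k (σ q) (σ p) (σ r) s t
        mq.1 b1 b2 mr.2 hs0 hst ht1 hk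
      refine ⟨_, hC, hB, ?_⟩
      rw [aux_end3 k γ θ σ _ p q r hp hpq hqr hr, v1, v2, v3, v4, v5, v6]
      · simp only [rot_eq, hθ0, hγ0]
        push_cast
        simp only [sub_mul, add_mul, neg_mul, Complex.exp_add, Complex.exp_sub, Complex.exp_neg,
          hE1, zero_mul, Complex.exp_zero]
        generalize Complex.exp (θ s * Complex.I) = a at *
        generalize Complex.exp (θ t * Complex.I) = b at *
        field_simp
        linear_combination hF
      · intro i h1 h2 h3 h4 h5
        obtain ⟨a, b, c, d⟩ := hne i h1 h2 h3 h4 h5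
        exact v7 _ a c b d
    · obtain ⟨hC, hB, v1, v2, v3, v4, v5, v6, v7⟩ := cuts3_spec k (σ r) (σ q) (σ p) s t
        mr.1 b1 b2 mp.2 hs0 hst ht1 hk
      refine ⟨_, hC, hB, ?_⟩
      rw [aux_end3 k γ θ σ _ p q r hp hpq hqr hr, v1, v2, v3, v4, v5, v6]
      · simp only [rot_eq, hθ0, hγ0]
        push_cast
        simp only [sub_mul, add_mul, neg_mul, Complex.exp_add, Complex.exp_sub, Complex.exp_neg,
          hE1, zero_mul, Complex.exp_zero]
        generalize Complex.exp (θ s * Complex.I) = a at *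
        generalize Complex.exp (θ t * Complex.I) = b at *
        field_simp
        linear_combination hF
      · intro i h1 h2 h3 h4 h5
        obtain ⟨a, b, c, d⟩ := hne i h1 h2 h3 h4 h5
        exact v7 _ a d c b
end
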